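/- Fix n ∈ ℕ and S ⊆ [n−1], and let Ω be the set of pairs (A,B) of disjoint subsets of [n−1] with |A| + |S| > |B|. Then for every positive integer r and every finite set Ξ ⊆ ℚ_{≥0}^Ω, there exist finite sets D ⊆ ℕ and Δ ⊆ ℕ^Ω such that: for every u ∈ ℚ₊^{n−1}, every x ∈ ℚ₊ and every coloring C : ℚ₊ → {1,…,r}, there exist d ∈ D and δ ∈ Δ such that, setting x' := (x + δ·ρ_u)/d^{|S|} and u' := (d·u₁,…,d·u_{n−1}), one has C(Π_{s∈S} u'_s · (x' + ξ·ρ_{u'})) = C(x' · Π_{s∈S} u'_s) for every ξ ∈ Ξ. -/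

import Mathlib

/-- The ratio `ρ_{(A,B)}(u) = (Π_{a ∈ A} u a) / (Π_{b ∈ B} u b)`. -/
def ratio (u : ℕ → ℚ) (AB : Finset ℕ × Finset ℕ) : ℚ :=
  (∏ a ∈ AB.1, u a) / (∏ b ∈ AB.2, u b)

open scoped Classical in
/-- The set `Ω` of pairs `(A, B)` of disjoint subsets of `[n-1]` with
`|A| + |S| > |B|`. -/
noncomputable def OmegaS (n : ℕ) (S : Finset ℕ) : Finset (Finset ℕ × Finset ℕ) :=
  ((Finset.Icc 1 (n - 1)).powerset ×ˢ (Finset.Icc 1 (n - 1)).powerset).filter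
    (fun AB => Disjoint AB.1 AB.2 ∧ AB.2.card < AB.1.card + S.card)

section PolyVdW

variable {G : Type} [AddCommGroup G]

/-- The normalized shift `x ↦ p (x + h) - p h`. -/
def shiftFn (h : ℕ) (p : ℕ → G) : ℕ → G := fun x => p (x + h) - p h

theorem shiftFn_add (h : ℕ) (p q : ℕ → G) :
    shiftFn h (p + q) = shiftFn h p + shiftFn h q := by
  funext x; simp only [shiftFn, Pi.add_apply]; abel

theorem shiftFn_neg (h : ℕ) (p : ℕ → G) : shiftFn h (-p) = -shiftFn h p := by
  funext x; simp only [shiftFn, Pi.neg_apply]; abel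

theorem shiftFn_zero (h : ℕ) : shiftFn h (0 : ℕ → G) = 0 := by
  funext x; simp [shiftFn]

/-- Polynomial maps of degree at most `k` vanishing at `0`. -/
def polyMaps (G : Type) [AddCommGroup G] : ℕ → AddSubgroup (ℕ → G)
  | 0 => ⊥
  | k + 1 =>
    { carrier := {f | f 0 = 0 ∧ ∀ h, shiftFn h f - f ∈ polyMaps G k}
      zero_mem' := by
        refine ⟨rfl, fun h => ?_⟩
        rw [shiftFn_zero, sub_zero]
        exact (polyMaps G k).zero_mem
      add_mem' := by
        rintro a b ⟨ha, ha'⟩ ⟨hb, hb'⟩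
        refine ⟨by simp [ha, hb], fun h => ?_⟩
        have := (polyMaps G k).add_mem (ha' h) (hb' h)
        rw [shiftFn_add]
        convert this using 1
        abel
      neg_mem' := by
        rintro a ⟨ha, ha'⟩
        refine ⟨by simp [ha], fun h => ?_⟩
        have := (polyMaps G k).neg_mem (ha' h)
        rw [shiftFn_neg]
        convert this using 1
        abel }

theorem mem_polyMaps_succ {k : ℕ} {f : ℕ → G} :
    f ∈ polyMaps G (k + 1) ↔ f 0 = 0 ∧ ∀ h, shiftFn h f - f ∈ polyMaps G k := Iff.rfl

theorem polyMaps_le_succ (k : ℕ) : polyMaps G k ≤ polyMaps G (k + 1) := by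
  induction k with
  | zero =>
    intro f hf
    have : f = 0 := by simpa [polyMaps] using hf
    rw [this]; exact AddSubgroup.zero_mem _
  | succ k ih =>
    intro f hf
    exact ⟨hf.1, fun h => ih (hf.2 h)⟩

theorem polyMaps_mono : Monotone (polyMaps G) := monotone_nat_of_le_succ polyMaps_le_succ

theorem polyMaps_apply_zero {k : ℕ} {f : ℕ → G} (hf : f ∈ polyMaps G k) : f 0 = 0 :=
  (polyMaps_le_succ k hf).1

theorem shiftFn_mem {k : ℕ} {f : ℕ → G} (hf : f ∈ polyMaps G k) (h : ℕ) :
    shiftFn h f ∈ polyMaps G k := by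
  have := (polyMaps G k).add_mem ((polyMaps_le_succ k hf).2 h) hf
  simpa using this

theorem monomial_mem (k : ℕ) : ∀ (e : ℕ), 1 ≤ e → e ≤ k → ∀ g : G,
    (fun d : ℕ => ((d : ℤ) ^ e) • g) ∈ polyMaps G k := by
  induction k with
  | zero => intro e h1 h2; omega
  | succ k ih =>
    intro e h1 h2 g
    obtain ⟨e, rfl⟩ : ∃ e', e = e' + 1 := ⟨e - 1, by omega⟩
    refine ⟨by simp, fun h => ?_⟩
    have key : shiftFn h (fun d : ℕ => ((d : ℤ) ^ (e + 1)) • g)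
        - (fun d : ℕ => ((d : ℤ) ^ (e + 1)) • g)
        = ∑ m ∈ Finset.range e, (fun d : ℕ => ((d : ℤ) ^ (m + 1)) •
          (((h : ℤ) ^ (e + 1 - (m + 1)) * ((e + 1).choose (m + 1) : ℤ)) • g)) := by
      funext d
      simp only [shiftFn, Pi.sub_apply, Finset.sum_apply, smul_smul]
      rw [← sub_smul, ← sub_smul, ← Finset.sum_smul]
      congr 1
      push_cast
      rw [add_pow, Finset.sum_range_succ, Finset.sum_range_succ']
      simp only [mul_assoc]
      simp
      ring
    rw [key]
    refine AddSubgroup.sum_mem _ fun m hm => ih _ (by omega) ?_ _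
    have := Finset.mem_range.1 hm
    omega

/-- The finitary van der Waerden property of a finite family of maps. -/
def VdW (A : Finset (ℕ → G)) : Prop :=
  ∀ (κ : Type) [Finite κ], ∃ (F : Finset G) (D : Finset ℕ), (∀ d ∈ D, 0 < d) ∧
    ∀ c : G → κ, ∃ a ∈ F, ∃ d ∈ D, ∀ p ∈ A, c (a + p d) = c a

open scoped Classical in
/-- The derived family. -/
noncomputable def derived (A : Finset (ℕ → G)) (f : ℕ → G) (H : Finset ℕ) : Finset (ℕ → G) :=
  (A ×ˢ H).image fun ph => shiftFn ph.2 ph.1 - f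

theorem mem_derived {A : Finset (ℕ → G)} {f : ℕ → G} {H : Finset ℕ} {p : ℕ → G} {h : ℕ}
    (hp : p ∈ A) (hh : h ∈ H) : shiftFn h p - f ∈ derived A f H :=
  by
  classical
  unfold derived
  exact Finset.mem_image.2 ⟨(p, h), Finset.mem_product.2 ⟨hp, hh⟩, rfl⟩

open scoped Classical in
theorem focus (A : Finset (ℕ → G)) (f : ℕ → G) (hA : ∀ p ∈ A, p 0 = 0)
    (hd : ∀ H, VdW (derived A f H)) (κ : Type) [Finite κ] (m : ℕ) :
    ∃ (F : Finset G) (D : Finset ℕ), (∀ d ∈ D, 0 < d) ∧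
    ∀ c : G → κ, (∃ a ∈ F, ∃ d ∈ D, ∀ p ∈ A, c (a + p d) = c a) ∨
      (∃ a ∈ F, ∃ t : Finset κ, t.card = m ∧
        ∀ k ∈ t, ∃ d ∈ D, ∀ p ∈ A, c (a + p d) = k) := by
  induction m with
  | zero =>
    exact ⟨{0}, ∅, by simp, fun c => Or.inr ⟨0, by simp, ∅, by simp, by simp⟩⟩
  | succ m ih =>
    obtain ⟨F, D, hD, hF⟩ := ih
    let B : Finset G := F ∪ (F ×ˢ (A ×ˢ D)).image fun x => x.1 + x.2.1 x.2.2
    have hB1 : ∀ a ∈ F, a ∈ B := fun a ha => Finset.mem_union_left _ ha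
    have hB2 : ∀ a ∈ F, ∀ p ∈ A, ∀ d ∈ D, a + p d ∈ B := fun a ha p hp d hd =>
      Finset.mem_union_right _ (Finset.mem_image.2 ⟨(a, p, d), by simp [ha, hp, hd], rfl⟩)
    obtain ⟨F', D', hD', hF'⟩ := hd (insert 0 D) (B → κ)
    refine ⟨(F' ×ˢ F).image (fun x => x.1 + x.2) ∪
        (F' ×ˢ (F ×ˢ D')).image (fun x => x.1 + x.2.1 - f x.2.2),
      D ∪ (D' ×ˢ insert 0 D).image (fun x => x.1 + x.2), ?_, fun c => ?_⟩
    · intro d hd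
      rcases Finset.mem_union.1 hd with hd | hd
      · exact hD d hd
      · obtain ⟨⟨x, y⟩, hxy, rfl⟩ := Finset.mem_image.1 hd
        have := hD' x (Finset.mem_product.1 hxy).1
        simp only
        omega
    obtain ⟨a', ha', d, hdD, hq⟩ := hF' (fun z b => c (z + b.1))
    have hq' : ∀ p ∈ A, ∀ h ∈ insert 0 D, ∀ b ∈ B,
        c (a' + (p (d + h) - p h - f d) + b) = c (a' + b) := by
      intro p hp h hh b hb
      exact congrFun (hq _ (mem_derived hp hh)) ⟨b, hb⟩
    have hfoc : ∀ a ∈ F, ∀ e ∈ D, (∀ p ∈ A, c (a' + (a + p e)) = c (a' + a)) →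
        ∃ a ∈ (F' ×ˢ F).image (fun x => x.1 + x.2) ∪
          (F' ×ˢ (F ×ˢ D')).image (fun x => x.1 + x.2.1 - f x.2.2),
        ∃ d ∈ D ∪ (D' ×ˢ insert 0 D).image (fun x => x.1 + x.2),
        ∀ p ∈ A, c (a + p d) = c a := by
      intro a ha e he hc
      refine ⟨a' + a, Finset.mem_union_left _
        (Finset.mem_image.2 ⟨(a', a), by simp [ha, ha'], rfl⟩), e,
        Finset.mem_union_left _ he, fun p hp => ?_⟩
      rw [add_assoc]; exact hc p hp
    rcases hF (fun z => c (a' + z)) with ⟨a, ha, e, he, hc⟩ | ⟨a, ha, t, ht, hc⟩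
    · exact Or.inl (hfoc a ha e he hc)
    · by_cases hmem : c (a' + a) ∈ t
      · obtain ⟨e, he, hc'⟩ := hc _ hmem
        exact Or.inl (hfoc a ha e he hc')
      · right
        refine ⟨a' + a - f d, Finset.mem_union_right _
          (Finset.mem_image.2 ⟨(a', a, d), by simp [ha, ha', hdD], rfl⟩),
          insert (c (a' + a)) t, by rw [Finset.card_insert_of_notMem hmem, ht], ?_⟩
        intro k hk
        rcases Finset.mem_insert.1 hk with rfl | hk
        · refine ⟨d + 0, Finset.mem_union_right _
            (Finset.mem_image.2 ⟨(d, 0), by simp [hdD], rfl⟩), fun p hp => ?_⟩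
          rw [← hq' p hp 0 (by simp) a (hB1 a ha), hA p hp]
          congr 1; abel
        · obtain ⟨e, he, hc'⟩ := hc k hk
          refine ⟨d + e, Finset.mem_union_right _
            (Finset.mem_image.2 ⟨(d, e), by simp [hdD, he], rfl⟩), fun p hp => ?_⟩
          rw [← hc' p hp]
          rw [← hq' p hp e (by simp [he]) _ (hB2 a ha p hp e he)]
          congr 1; abel

theorem vdw_step (A : Finset (ℕ → G)) (f : ℕ → G) (hA : ∀ p ∈ A, p 0 = 0)
    (hd : ∀ H, VdW (derived A f H)) : VdW A := by
  intro κ _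
  have := Fintype.ofFinite κ
  obtain ⟨F, D, hD, h⟩ := focus A f hA hd κ (Fintype.card κ + 1)
  refine ⟨F, D, hD, fun c => ?_⟩
  rcases h c with h | ⟨a, _, t, ht, _⟩
  · exact h
  · have := Finset.card_le_univ t
    omega

/-- Sets of maps closed under shifts and perturbations of degree at most `j`. -/
def GoodSet (j : ℕ) (U : Set (ℕ → G)) : Prop :=
  ∀ p ∈ U, p 0 = 0 ∧ ∀ h, ∀ v ∈ polyMaps G j, shiftFn h p + v ∈ U

/-- Union of the classes modulo degree at most `j` of the elements of `R`. -/
def classes (j : ℕ) (R : Finset (ℕ → G)) : Set (ℕ → G) :=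
  {p | ∃ r ∈ R, p - r ∈ polyMaps G j}

theorem class_shift {j : ℕ} {r p v : ℕ → G} (hr : r ∈ polyMaps G (j + 1))
    (hp : p - r ∈ polyMaps G j) (hv : v ∈ polyMaps G j) (h : ℕ) :
    shiftFn h p + v - r ∈ polyMaps G j := by
  have h1 := shiftFn_mem hp h
  have h2 := hr.2 h
  have h3 := (polyMaps G j).add_mem ((polyMaps G j).add_mem h1 h2) hv
  convert h3 using 1
  have : shiftFn h p = shiftFn h (p - r) + shiftFn h r := by
    rw [← shiftFn_add, sub_add_cancel]
  rw [this]; abel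

open scoped Classical in
theorem vdw_main (j : ℕ) : ∀ U : Set (ℕ → G), GoodSet j U →
    (∀ A : Finset (ℕ → G), (A : Set (ℕ → G)) ⊆ U → VdW A) →
    ∀ A : Finset (ℕ → G), (A : Set (ℕ → G)) ⊆ U ∪ (polyMaps G j : Set (ℕ → G)) → VdW A := by
  induction j with
  | zero =>
    intro U _ hU A hA κ _
    obtain ⟨F, D, hD, h⟩ := hU (A.filter (· ∈ U)) (by intro p hp; simpa using (Finset.mem_filter.1 hp).2) κ
    refine ⟨F, D, hD, fun c => ?_⟩
    obtain ⟨a, ha, d, hd, hc⟩ := h c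
    refine ⟨a, ha, d, hd, fun p hp => ?_⟩
    rcases hA hp with hpU | hp0
    · exact hc p (Finset.mem_filter.2 ⟨hp, hpU⟩)
    · have : p = 0 := by simpa [polyMaps] using hp0
      simp [this]
  | succ j ih =>
    intro U hgood hU
    have inner : ∀ m : ℕ, ∀ R : Finset (ℕ → G), R.card = m →
        (∀ r ∈ R, r ∈ polyMaps G (j + 1)) →
        ∀ A : Finset (ℕ → G), (A : Set (ℕ → G)) ⊆ U ∪ classes j R → VdW A := by
      intro m
      induction m with
      | zero =>
        intro R hR _ A hA
        have : R = ∅ := Finset.card_eq_zero.1 hR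
        subst this
        exact hU A fun p hp => by
          rcases hA hp with h | ⟨r, hr, _⟩
          · exact h
          · simp at hr
      | succ m ihm =>
        intro R hR hRV A hA
        obtain ⟨f, hf⟩ : R.Nonempty := Finset.card_pos.1 (by omega)
        have hfV := hRV f hf
        have hA0 : ∀ p ∈ A, p 0 = 0 := by
          intro p hp
          rcases hA hp with h | ⟨r, hr, hpr⟩
          · exact (hgood p h).1
          · have h1 := polyMaps_apply_zero hpr
            have h2 := polyMaps_apply_zero (hRV r hr)
            simpa [h2] using h1
        refine vdw_step A f hA0 fun H => ?_
        let R' := (R.erase f).image (fun r => r - f)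
        have hR'V : ∀ r ∈ R', r ∈ polyMaps G (j + 1) := by
          intro r hr
          obtain ⟨s, hs, rfl⟩ := Finset.mem_image.1 hr
          exact AddSubgroup.sub_mem _ (hRV s (Finset.mem_of_mem_erase hs)) hfV
        have hR'c : R'.card = m := by
          rw [Finset.card_image_of_injective _ (sub_left_injective), Finset.card_erase_of_mem hf]
          omega
        refine ih (U ∪ classes j R') ?_ (ihm R' hR'c hR'V) _ ?_
        · rintro p (hp | ⟨r, hr, hpr⟩)
          · exact ⟨(hgood p hp).1, fun h v hv =>
              Or.inl ((hgood p hp).2 h v (polyMaps_le_succ j hv))⟩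
          · refine ⟨?_, fun h v hv => Or.inr ⟨r, hr, class_shift (hR'V r hr) hpr hv h⟩⟩
            have h1 := polyMaps_apply_zero hpr
            have h2 := polyMaps_apply_zero (hR'V r hr)
            simpa [h2] using h1
        · intro q hq
          obtain ⟨⟨p, h⟩, hph, rfl⟩ := Finset.mem_image.1 (Finset.mem_coe.1 hq)
          have hp := (Finset.mem_product.1 hph).1
          simp only
          rcases hA hp with hpU | ⟨r, hr, hpr⟩
          · left; left
            rw [sub_eq_add_neg]
            exact (hgood p hpU).2 h _ (AddSubgroup.neg_mem _ hfV)
          · have h1 := class_shift (hRV r hr) hpr (AddSubgroup.zero_mem _) h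
            rw [add_zero] at h1
            by_cases hrf : r = f
            · right; rw [← hrf]; exact h1
            · left; right
              refine ⟨r - f, Finset.mem_image.2 ⟨r, Finset.mem_erase.2 ⟨hrf, hr⟩, rfl⟩, ?_⟩
              convert h1 using 1
              abel
    intro A hA
    refine inner _ (A.filter (· ∈ polyMaps G (j + 1))) rfl
      (fun r hr => (Finset.mem_filter.1 hr).2) A fun p hp => ?_
    rcases hA hp with h | h
    · exact Or.inl h
    · exact Or.inr ⟨p, Finset.mem_filter.2 ⟨hp, h⟩, by
        rw [sub_self]; exact AddSubgroup.zero_mem _⟩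

theorem vdw_poly (j : ℕ) (A : Finset (ℕ → G)) (hA : ∀ p ∈ A, p ∈ polyMaps G j) : VdW A := by
  refine vdw_main j ∅ (fun p hp => hp.elim) ?_ A (fun p hp => Or.inr (hA p hp))
  intro A hA κ _
  have : A = ∅ := by
    ext p; constructor
    · intro hp; exact (hA hp).elim
    · intro hp; simp at hp
  subst this
  exact ⟨{0}, {1}, by simp, fun c => ⟨0, by simp, 1, by simp, by simp⟩⟩

end PolyVdW

theorem ratio_scale (u : ℕ → ℚ) (AB : Finset ℕ × Finset ℕ) (d : ℚ) (hd : d ≠ 0) (s : ℕ)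
    (h : AB.2.card < AB.1.card + s) :
    d ^ s * ratio (fun i => d * u i) AB = d ^ (AB.1.card + s - AB.2.card) * ratio u AB := by
  unfold ratio
  rw [Finset.prod_mul_distrib, Finset.prod_mul_distrib, Finset.prod_const, Finset.prod_const]
  have : d ^ (AB.1.card + s - AB.2.card) = d ^ AB.1.card * d ^ s / d ^ AB.2.card := by
    rw [pow_sub₀ _ hd h.le, pow_add]; rfl
  rw [this, mul_div_mul_comm]
  ring

/-- **General term-shifting lemma.** Fix `n` and `S ⊆ [n-1]`, and let `Ω` be the
set of pairs `(A,B)` of disjoint subsets of `[n-1]` with `|A| + |S| > |B|`.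
For every positive integer `r` and finite `Ξ ⊆ ℚ_{≥0}^Ω` there are finite sets
`D ⊆ ℕ`, `Δ ⊆ ℕ^Ω` such that: for any `u ∈ ℚ₊^{n-1}`, `x ∈ ℚ₊` and `r`-coloring
`C` of `ℚ₊`, there are `d ∈ D` and `δ ∈ Δ` such that, setting
`x' := (x + δ·ρ_u)/d^{|S|}` and `u' := d·u`, we have
`C(Π_{s∈S} u' s · (x' + ξ·ρ_{u'})) = C(x' · Π_{s∈S} u' s)` for every `ξ ∈ Ξ`. -/
theorem general_term_shift (n : ℕ) (S : Finset ℕ) (hS : S ⊆ Finset.Icc 1 (n - 1))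
    (r : ℕ) (hr : 0 < r)
    (Ξ : Finset ((Finset ℕ × Finset ℕ) → ℚ))
    (hΞ : ∀ ξ ∈ Ξ, ∀ AB ∈ OmegaS n S, 0 ≤ ξ AB) :
    ∃ (D : Finset ℕ) (Δ : Finset ((Finset ℕ × Finset ℕ) → ℕ)),
      (∀ d ∈ D, 0 < d) ∧ (∀ δ ∈ Δ, ∀ AB ∈ OmegaS n S, 0 < δ AB) ∧
      ∀ u : ℕ → ℚ, (∀ i ∈ Finset.Icc 1 (n - 1), 0 < u i) →
      ∀ x : ℚ, 0 < x → ∀ C : ℚ → Fin r,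
        ∃ d ∈ D, ∃ δ ∈ Δ,
          ∀ x' : ℚ,
            x' = (x + ∑ AB ∈ OmegaS n S, (δ AB : ℚ) * ratio u AB) / (d : ℚ) ^ S.card →
          ∀ u' : ℕ → ℚ, u' = (fun i => (d : ℚ) * u i) →
          ∀ ξ ∈ Ξ,
            C ((∏ s ∈ S, u' s) * (x' + ∑ AB ∈ OmegaS n S, ξ AB * ratio u' AB)) =
              C (x' * ∏ s ∈ S, u' s) := by
  classical
  have hexp : ∀ AB ∈ OmegaS n S, AB.2.card < AB.1.card + S.card := by
    intro AB h
    unfold OmegaS at h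
    exact (Finset.mem_filter.1 h).2.2
  let e : Finset ℕ × Finset ℕ → ℕ := fun AB => AB.1.card + S.card - AB.2.card
  let M : ℕ := ∏ ξ ∈ Ξ, ∏ AB ∈ OmegaS n S, (ξ AB).den
  have hM : 0 < M := Finset.prod_pos fun ξ _ => Finset.prod_pos fun AB _ => (ξ AB).den_pos
  have hz : ∀ ξ : (Finset ℕ × Finset ℕ) → ℚ, ∀ AB : Finset ℕ × Finset ℕ, ∃ z : ℤ,
      ξ ∈ Ξ → AB ∈ OmegaS n S → (z : ℚ) = (M : ℚ) ^ e AB * ξ AB := by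
    intro ξ AB
    by_cases h : ξ ∈ Ξ ∧ AB ∈ OmegaS n S
    · have hdvd : (ξ AB).den ∣ M ^ e AB := by
        refine dvd_trans ?_ (dvd_pow_self M ?_)
        · exact dvd_trans (Finset.dvd_prod_of_mem (fun AB => (ξ AB).den) h.2)
            (Finset.dvd_prod_of_mem (fun ξ : (Finset ℕ × Finset ℕ) → ℚ =>
              ∏ AB ∈ OmegaS n S, (ξ AB).den) h.1)
        · have := hexp AB h.2
          simp only [e]; omega
      obtain ⟨k, hk⟩ := hdvd
      refine ⟨k * (ξ AB).num, fun _ _ => ?_⟩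
      have h1 : (M : ℚ) ^ e AB = (ξ AB).den * k := by exact_mod_cast hk
      rw [h1]
      have h2 := Rat.mul_den_eq_num (ξ AB)
      push_cast
      rw [← h2]; ring
    · exact ⟨0, fun h1 h2 => absurd ⟨h1, h2⟩ h⟩
  choose z hz using hz
  let P : ((Finset ℕ × Finset ℕ) → ℚ) → ℕ → ((Finset ℕ × Finset ℕ) → ℤ) := fun ξ =>
    ∑ AB ∈ OmegaS n S, fun d : ℕ => ((d : ℤ) ^ e AB) • (Pi.single AB (z ξ AB))
  have hP : ∀ ξ, P ξ ∈ polyMaps ((Finset ℕ × Finset ℕ) → ℤ) (∑ AB ∈ OmegaS n S, e AB) := by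
    intro ξ
    refine AddSubgroup.sum_mem _ fun AB hAB => monomial_mem _ _ ?_ ?_ _
    · have := hexp AB hAB
      simp only [e]; omega
    · exact Finset.single_le_sum (f := e) (fun _ _ => Nat.zero_le _) hAB
  have hPval : ∀ ξ d, ∀ AB ∈ OmegaS n S, P ξ d AB = (d : ℤ) ^ e AB * z ξ AB := by
    intro ξ d AB hAB
    simp only [P, Finset.sum_apply, Pi.smul_apply, smul_eq_mul]
    rw [Finset.sum_eq_single AB]
    · simp
    · intro b _ hb
      simp [Pi.single_apply, Ne.symm hb]
    · intro h; exact absurd hAB h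
  obtain ⟨F, D, hD, hvdw⟩ := vdw_poly _ (Ξ.image P) (by
    intro p hp
    obtain ⟨ξ, _, rfl⟩ := Finset.mem_image.1 hp
    exact hP ξ) (Fin r)
  let K : ℤ := 1 + ∑ a ∈ F, ∑ AB ∈ OmegaS n S, |a AB|
  have hK : ∀ a ∈ F, ∀ AB ∈ OmegaS n S, 0 < a AB + K := by
    intro a ha AB hAB
    have h1 : |a AB| ≤ ∑ AB ∈ OmegaS n S, |a AB| :=
      Finset.single_le_sum (f := fun AB => |a AB|) (fun _ _ => abs_nonneg _) hAB
    have h2 : ∑ AB ∈ OmegaS n S, |a AB| ≤ ∑ a ∈ F, ∑ AB ∈ OmegaS n S, |a AB| :=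
      Finset.single_le_sum (f := fun a : (Finset ℕ × Finset ℕ) → ℤ => ∑ AB ∈ OmegaS n S, |a AB|)
        (fun _ _ => Finset.sum_nonneg fun _ _ => abs_nonneg _) ha
    have h3 := neg_abs_le (a AB)
    simp only [K]; omega
  refine ⟨D.image (fun d => M * d), F.image (fun a AB => (a AB + K).toNat), ?_, ?_, ?_⟩
  · intro d hd
    obtain ⟨d, hd', rfl⟩ := Finset.mem_image.1 hd
    exact Nat.mul_pos hM (hD d hd')
  · intro δ hδ AB hAB
    obtain ⟨a, ha, rfl⟩ := Finset.mem_image.1 hδ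
    have := hK a ha AB hAB
    simp only; omega
  intro u _ x _ C
  obtain ⟨a, ha, d, hd, hc⟩ := hvdw (fun a =>
    C ((∏ s ∈ S, u s) * (x + ∑ AB ∈ OmegaS n S, ((a AB + K : ℤ) : ℚ) * ratio u AB)))
  refine ⟨M * d, Finset.mem_image_of_mem _ hd, _, Finset.mem_image_of_mem _ ha, ?_⟩
  rintro x' hx' u' rfl ξ hξ
  have hdpos := hD d hd
  have hMd : ((M * d : ℕ) : ℚ) ≠ 0 := by
    exact_mod_cast (Nat.mul_pos hM hdpos).ne'
  have hsum : ∑ AB ∈ OmegaS n S, (((a AB + K).toNat : ℕ) : ℚ) * ratio u AB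
      = ∑ AB ∈ OmegaS n S, ((a AB + K : ℤ) : ℚ) * ratio u AB := by
    refine Finset.sum_congr rfl fun AB hAB => ?_
    congr 1
    have h1 : (((a AB + K).toNat : ℕ) : ℤ) = a AB + K := Int.toNat_of_nonneg (hK a ha AB hAB).le
    exact_mod_cast congrArg (fun t : ℤ => (t : ℚ)) h1
  rw [hsum] at hx'
  have hprod : ∏ s ∈ S, ((M * d : ℕ) : ℚ) * u s = ((M * d : ℕ) : ℚ) ^ S.card * ∏ s ∈ S, u s := by
    rw [Finset.prod_mul_distrib, Finset.prod_const]
  have hx2 : ((M * d : ℕ) : ℚ) ^ S.card * x' =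
      x + ∑ AB ∈ OmegaS n S, ((a AB + K : ℤ) : ℚ) * ratio u AB := by
    rw [hx']; field_simp
  have hmain := hc (P ξ) (Finset.mem_image_of_mem _ hξ)
  have hR : x' * ∏ s ∈ S, ((M * d : ℕ) : ℚ) * u s = (∏ s ∈ S, u s) *
      (x + ∑ AB ∈ OmegaS n S, ((a AB + K : ℤ) : ℚ) * ratio u AB) := by
    rw [hprod, ← hx2]; ring
  have hterm : ((M * d : ℕ) : ℚ) ^ S.card *
      ∑ AB ∈ OmegaS n S, ξ AB * ratio (fun i => ((M * d : ℕ) : ℚ) * u i) AB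
      = ∑ AB ∈ OmegaS n S, ((P ξ d AB : ℤ) : ℚ) * ratio u AB := by
    rw [Finset.mul_sum]
    refine Finset.sum_congr rfl fun AB hAB => ?_
    rw [mul_left_comm, ratio_scale u AB _ hMd _ (hexp AB hAB), hPval ξ d AB hAB]
    push_cast
    rw [hz ξ AB hξ hAB, mul_pow]
    simp only [e]
    ring
  have hL : (∏ s ∈ S, ((M * d : ℕ) : ℚ) * u s) *
      (x' + ∑ AB ∈ OmegaS n S, ξ AB * ratio (fun i => ((M * d : ℕ) : ℚ) * u i) AB)
      = (∏ s ∈ S, u s) *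
      (x + ∑ AB ∈ OmegaS n S, (((a + P ξ d) AB + K : ℤ) : ℚ) * ratio u AB) := by
    have h1 : ∑ AB ∈ OmegaS n S, (((a + P ξ d) AB + K : ℤ) : ℚ) * ratio u AB
        = ∑ AB ∈ OmegaS n S, ((a AB + K : ℤ) : ℚ) * ratio u AB
          + ∑ AB ∈ OmegaS n S, ((P ξ d AB : ℤ) : ℚ) * ratio u AB := by
      rw [← Finset.sum_add_distrib]
      refine Finset.sum_congr rfl fun AB _ => ?_
      rw [Pi.add_apply]; push_cast; ring
    rw [h1, ← add_assoc, ← hx2, ← hterm, hprod]; ring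
  rw [hL, hR]
  exact hmain
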